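/- Let α, L₁, L₂ be real numbers with 0 < α < π/2 and L₁·L₂ < 0, and let y, z, θ, u, v, ω be real numbers satisfying z + L₁·θ ≥ 0, z + L₂·θ ≥ 0, and y ≤ (1/2)·(cos α / sin α)·z. Define V₁ = (1/2)·(u² + v² + ω²) + z·cos α − y·sin α. Then: V₁ ≥ (1/2)·cos α·|z|, V₁ ≥ (1/2)·cos α·min(|L₁|,|L₂|)·|θ|, V₁ ≥ sin α·|y|, V₁ ≥ (1/2)·u², V₁ ≥ (1/2)·v², and V₁ ≥ (1/2)·ω². -/

import Mathlib

theorem min_abs_mul_abs_le {L₁ L₂ z θ : ℝ} (hL : L₁ * L₂ < 0)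
    (h1 : 0 ≤ z + L₁ * θ) (h2 : 0 ≤ z + L₂ * θ) : min |L₁| |L₂| * |θ| ≤ z := by
  have of_nonpos : L₁ * θ ≤ 0 ∨ L₂ * θ ≤ 0 := by
    by_contra! h
    nlinarith [mul_pos h.1 h.2, sq_nonneg θ]
  rcases of_nonpos with h | h
  · calc min |L₁| |L₂| * |θ| ≤ |L₁| * |θ| := by gcongr; exact min_le_left _ _
      _ = -(L₁ * θ) := by rw [← abs_mul, abs_of_nonpos h]
      _ ≤ z := by linarith
  · calc min |L₁| |L₂| * |θ| ≤ |L₂| * |θ| := by gcongr; exact min_le_right _ _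
      _ = -(L₂ * θ) := by rw [← abs_mul, abs_of_nonpos h]
      _ ≤ z := by linarith


/-- Verification of condition 3a) for the planar biped on the half-space
`y ≤ (1/2)·cot(α)·z`: lower bounds on the total mechanical energy `V₁`. -/
theorem V1_bounds (α L₁ L₂ y z θ u v ω V₁ : ℝ)
    (hα0 : 0 < α) (hα1 : α < Real.pi / 2) (hL : L₁ * L₂ < 0)
    (h1 : z + L₁ * θ ≥ 0) (h2 : z + L₂ * θ ≥ 0)
    (hy : y ≤ (1 / 2) * (Real.cos α / Real.sin α) * z)
    (hV : V₁ = (1 / 2) * (u ^ 2 + v ^ 2 + ω ^ 2) + z * Real.cos α - y * Real.sin α) :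
    V₁ ≥ (1 / 2) * Real.cos α * |z| ∧
    V₁ ≥ (1 / 2) * Real.cos α * min |L₁| |L₂| * |θ| ∧
    V₁ ≥ Real.sin α * |y| ∧
    V₁ ≥ (1 / 2) * u ^ 2 ∧ V₁ ≥ (1 / 2) * v ^ 2 ∧ V₁ ≥ (1 / 2) * ω ^ 2 := by
  have hs : 0 < Real.sin α := Real.sin_pos_of_pos_of_lt_pi hα0 (by linarith [Real.pi_pos])
  have hc : 0 < Real.cos α := Real.cos_pos_of_mem_Ioo ⟨by linarith, hα1⟩
  have hθ : min |L₁| |L₂| * |θ| ≤ z := min_abs_mul_abs_le hL h1 h2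
  have hz : 0 ≤ z := le_trans (by positivity) hθ
  have hcz : 0 ≤ Real.cos α * z := by positivity
  have hys : y * Real.sin α ≤ 1 / 2 * (Real.cos α * z) := by
    calc y * Real.sin α ≤ (1 / 2) * (Real.cos α / Real.sin α) * z * Real.sin α := by gcongr
      _ = 1 / 2 * (Real.cos α * z) := by field_simp
  have hcθ := mul_le_mul_of_nonneg_left hθ hc.le
  have hu := sq_nonneg u
  have hv := sq_nonneg v
  have hω := sq_nonneg ω
  refine ⟨?_, by linarith, ?_, by linarith, by linarith, by linarith⟩
  · rw [abs_of_nonneg hz]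
    linarith
  · rcases abs_cases y with ⟨h, -⟩ | ⟨h, -⟩ <;> rw [h] <;> linarith
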